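/- The minimum of the forward value function over all possible final vertices equals the optimal objective: min over i ∈ V_c of u(V, i) equals the minimum of the total service disruption time T(σ) over all repair sequences σ. -/

import Mathlib

/-- `W n pre S` is the number of vertices of `V_c = {1,…,n}` without power service
when exactly the vertices in `S` have been repaired: vertices `j` having some
predecessor-or-self `i` (i.e. `pre i j`) that is not in `S`. -/
noncomputable def W (n : ℕ) (pre : ℕ → ℕ → Prop) (S : Finset ℕ) : ℕ :=
  {j | j ∈ Finset.Icc 1 n ∧ ∃ i ∈ Finset.Icc 1 n, pre i j ∧ i ∉ S}.ncard

/-- `jseq σ p` is the `p`-th visited vertex: the depot `0` for `p = 0`, and `σ p` otherwise. -/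
def jseq (σ : ℕ → ℕ) (p : ℕ) : ℕ := if p = 0 then 0 else σ p

/-- Arrival time at the `p`-th visited vertex: `t_p = ∑_{q=1}^p d(j_{q-1}, j_q)`. -/
def arrival (d : ℕ → ℕ → ℝ) (σ : ℕ → ℕ) (p : ℕ) : ℝ :=
  ∑ q ∈ Finset.Icc 1 p, d (jseq σ (q - 1)) (jseq σ q)

/-- `lastPos n pre σ i = max { p ∈ [1,n] : σ p ⪰ i }`, the position at which the
service of vertex `i` is restored. -/
noncomputable def lastPos (n : ℕ) (pre : ℕ → ℕ → Prop) (σ : ℕ → ℕ) (i : ℕ) : ℕ :=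
  sSup {p : ℕ | p ∈ Finset.Icc 1 n ∧ pre (σ p) i}

/-- Total service disruption time `T(σ) = ∑_{i ∈ V_c} r_i` where `r_i = t_{p(i)}`. -/
noncomputable def totalT (n : ℕ) (d : ℕ → ℕ → ℝ) (pre : ℕ → ℕ → Prop) (σ : ℕ → ℕ) : ℝ :=
  ∑ i ∈ Finset.Icc 1 n, arrival d σ (lastPos n pre σ i)

/-- Forward value function `u(X, i)`: the minimum over all orderings `(y_1,…,y_m)` of
`X ∖ {0}` ending at `y_m = i` (with `m = |X| − 1` and `y_0 = 0`) of
`∑_{p=1}^{m} W({y_1,…,y_{p−1}}) · d(y_{p−1}, y_p)`; in particular `u({0}, 0) = 0`. -/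
noncomputable def uval (n : ℕ) (d : ℕ → ℕ → ℝ) (pre : ℕ → ℕ → Prop) (X : Finset ℕ) (i : ℕ) : ℝ :=
  sInf { c : ℝ | ∃ y : ℕ → ℕ, Set.BijOn y (Set.Icc 1 (X.card - 1)) ↑(X.erase 0) ∧
    y (X.card - 1) = i ∧
    c = ∑ p ∈ Finset.Icc 1 (X.card - 1),
      (W n pre ((Finset.Icc 1 (p - 1)).image y) : ℝ) * d (jseq y (p - 1)) (jseq y p) }

/-- `weightedCost n d pre σ` is the length of the route `σ` in which each leg is weighted by the
number of vertices that are without power while it is travelled. -/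
noncomputable def weightedCost (n : ℕ) (d : ℕ → ℕ → ℝ) (pre : ℕ → ℕ → Prop) (σ : ℕ → ℕ) : ℝ :=
  ∑ p ∈ Finset.Icc 1 n,
    (W n pre ((Finset.Icc 1 (p - 1)).image σ) : ℝ) * d (jseq σ (p - 1)) (jseq σ p)

theorem lastPos_le (n : ℕ) (pre : ℕ → ℕ → Prop) (σ : ℕ → ℕ) (i : ℕ) :
    lastPos n pre σ i ≤ n :=
  csSup_le' fun _ hp => (Finset.mem_Icc.1 hp.1).2

theorem le_lastPos_iff {n : ℕ} {pre : ℕ → ℕ → Prop} {σ : ℕ → ℕ} {i q : ℕ} (hq : 1 ≤ q) :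
    q ≤ lastPos n pre σ i ↔ ∃ p ∈ Finset.Icc 1 n, q ≤ p ∧ pre (σ p) i := by
  have hbdd : BddAbove {p : ℕ | p ∈ Finset.Icc 1 n ∧ pre (σ p) i} :=
    ⟨n, fun _ hp => (Finset.mem_Icc.1 hp.1).2⟩
  constructor
  · intro h
    have hne : {p : ℕ | p ∈ Finset.Icc 1 n ∧ pre (σ p) i}.Nonempty := by
      by_contra hempty
      rw [Set.not_nonempty_iff_eq_empty] at hempty
      simp only [lastPos, hempty, csSup_empty, bot_eq_zero] at h
      omega
    obtain ⟨hmem, hpre⟩ := Nat.sSup_mem hne hbdd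
    exact ⟨_, hmem, h, hpre⟩
  · rintro ⟨p, hp, hqp, hpre⟩
    exact hqp.trans (le_csSup hbdd ⟨hp, hpre⟩)

theorem W_image_eq_card {n : ℕ} {pre : ℕ → ℕ → Prop} {σ : ℕ → ℕ}
    (hσ : Set.BijOn σ (Set.Icc 1 n) (Set.Icc 1 n)) {q : ℕ} (hq : q ∈ Finset.Icc 1 n) :
    W n pre ((Finset.Icc 1 (q - 1)).image σ) =
      ((Finset.Icc 1 n).filter fun i => q ≤ lastPos n pre σ i).card := by
  obtain ⟨hq1, hqn⟩ := Finset.mem_Icc.1 hq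
  rw [W, ← Set.ncard_coe_finset]
  congr 1
  ext j
  simp only [Set.mem_ofPred_eq, Finset.coe_filter, le_lastPos_iff hq1]
  refine and_congr_right fun _ => ⟨?_, ?_⟩
  · rintro ⟨i, hi, hij, hnot⟩
    obtain ⟨p, hp, rfl⟩ := hσ.surjOn (Finset.mem_Icc.1 hi)
    refine ⟨p, Finset.mem_Icc.2 hp, ?_, hij⟩
    by_contra hlt
    exact hnot (Finset.mem_image_of_mem σ (Finset.mem_Icc.2 ⟨hp.1, by omega⟩))
  · rintro ⟨p, hp, hqp, hpre⟩
    have hp' := Finset.mem_Icc.1 hp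
    refine ⟨σ p, Finset.mem_Icc.2 (hσ.mapsTo hp'), hpre, fun hmem => ?_⟩
    obtain ⟨r, hr, hrp⟩ := Finset.mem_image.1 hmem
    have hr' := Finset.mem_Icc.1 hr
    have := hσ.injOn (show r ∈ Set.Icc 1 n from ⟨hr'.1, by omega⟩) hp' hrp
    omega

theorem totalT_eq_weightedCost {n : ℕ} (d : ℕ → ℕ → ℝ) (pre : ℕ → ℕ → Prop) {σ : ℕ → ℕ}
    (hσ : Set.BijOn σ (Set.Icc 1 n) (Set.Icc 1 n)) :
    totalT n d pre σ = weightedCost n d pre σ := by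
  have harr : ∀ i, arrival d σ (lastPos n pre σ i) =
      ∑ q ∈ Finset.Icc 1 n,
        if q ≤ lastPos n pre σ i then d (jseq σ (q - 1)) (jseq σ q) else 0 := by
    intro i
    rw [arrival, ← Finset.sum_filter]
    refine Finset.sum_congr ?_ fun _ _ => rfl
    have := lastPos_le n pre σ i
    ext q
    simp only [Finset.mem_Icc, Finset.mem_filter]
    omega
  simp only [totalT, harr]
  rw [Finset.sum_comm, weightedCost]
  refine Finset.sum_congr rfl fun q hq => ?_
  rw [W_image_eq_card hσ hq, ← Finset.sum_filter, Finset.sum_const, nsmul_eq_mul]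

theorem weightedCost_nonneg (n : ℕ) {d : ℕ → ℕ → ℝ} (hd : ∀ i j, 0 ≤ d i j)
    (pre : ℕ → ℕ → Prop) (σ : ℕ → ℕ) : 0 ≤ weightedCost n d pre σ :=
  Finset.sum_nonneg fun _ _ => mul_nonneg (Nat.cast_nonneg _) (hd _ _)

theorem uval_Icc_eq (n : ℕ) (d : ℕ → ℕ → ℝ) (pre : ℕ → ℕ → Prop) (i : ℕ) :
    uval n d pre (Finset.Icc 0 n) i =
      sInf {c : ℝ | ∃ σ : ℕ → ℕ, Set.BijOn σ (Set.Icc 1 n) (Set.Icc 1 n) ∧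
        σ n = i ∧ c = weightedCost n d pre σ} := by
  have hcard : (Finset.Icc 0 n).card - 1 = n := by simp
  have herase : (((Finset.Icc 0 n).erase 0 : Finset ℕ) : Set ℕ) = Set.Icc 1 n := by
    ext j
    simp only [Finset.coe_erase, Finset.coe_Icc, Set.mem_sdiff, Set.mem_Icc,
      Set.mem_singleton_iff]
    omega
  simp only [uval, hcard, herase, weightedCost]

theorem exists_bijOn_Icc_last_eq {n i : ℕ} (hi : i ∈ Set.Icc 1 n) :
    ∃ σ : ℕ → ℕ, Set.BijOn σ (Set.Icc 1 n) (Set.Icc 1 n) ∧ σ n = i := by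
  have hn : n ∈ Set.Icc 1 n := ⟨hi.1.trans hi.2, le_rfl⟩
  have hmaps : Set.MapsTo (Equiv.swap n i) (Set.Icc 1 n) (Set.Icc 1 n) := by
    intro x hx
    rw [Equiv.swap_apply_def]
    split_ifs <;> assumption
  refine ⟨Equiv.swap n i, ⟨hmaps, (Equiv.injective _).injOn, fun x hx => ?_⟩,
    Equiv.swap_apply_left n i⟩
  exact ⟨Equiv.swap n i x, hmaps hx, Equiv.swap_apply_self n i x⟩

/-- The minimum of the forward value function over all possible final
vertices equals the optimal objective:
`min_{i ∈ V_c} u(V, i) = min_σ T(σ)` over all repair sequences `σ`. -/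
theorem stmt17
    (n : ℕ) (hn : 1 ≤ n)
    (d : ℕ → ℕ → ℝ) (hd : ∀ i j, 0 ≤ d i j)
    (pre : ℕ → ℕ → Prop)
    (hrefl : ∀ i ∈ Finset.Icc 1 n, pre i i)
    (htrans : ∀ i j k, pre i j → pre j k → pre i k)
    (hantisymm : ∀ i j, pre i j → pre j i → i = j)
    :
    sInf { c : ℝ | ∃ i ∈ Finset.Icc 1 n, c = uval n d pre (Finset.Icc 0 n) i }
      = sInf { c : ℝ | ∃ σ : ℕ → ℕ,
          Set.BijOn σ (Set.Icc 1 n) (Set.Icc 1 n) ∧ c = totalT n d pre σ } := by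
  have hn_mem : n ∈ Set.Icc 1 n := ⟨hn, le_rfl⟩
  apply le_antisymm
  · refine le_csInf ⟨_, id, Set.bijOn_id _, rfl⟩ ?_
    rintro _ ⟨σ, hσ, rfl⟩
    rw [totalT_eq_weightedCost d pre hσ]
    refine le_trans (csInf_le ⟨0, ?_⟩ ⟨σ n, Finset.mem_Icc.2 (hσ.mapsTo hn_mem), rfl⟩) ?_
    · rintro _ ⟨i, -, rfl⟩
      rw [uval_Icc_eq]
      refine Real.sInf_nonneg ?_
      rintro _ ⟨τ, -, -, rfl⟩
      exact weightedCost_nonneg n hd pre τ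
    · rw [uval_Icc_eq]
      refine csInf_le ⟨0, ?_⟩ ⟨σ, hσ, rfl, rfl⟩
      rintro _ ⟨τ, -, -, rfl⟩
      exact weightedCost_nonneg n hd pre τ
  · refine le_csInf ⟨_, n, Finset.mem_Icc.2 hn_mem, rfl⟩ ?_
    rintro _ ⟨i, hi, rfl⟩
    rw [uval_Icc_eq]
    obtain ⟨τ, hτ, hτn⟩ := exists_bijOn_Icc_last_eq (Finset.mem_Icc.1 hi)
    refine le_csInf ⟨_, τ, hτ, hτn, rfl⟩ ?_
    rintro _ ⟨σ, hσ, -, rfl⟩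
    refine csInf_le ⟨0, ?_⟩ ⟨σ, hσ, (totalT_eq_weightedCost d pre hσ).symm⟩
    rintro _ ⟨ρ, hρ, rfl⟩
    rw [totalT_eq_weightedCost d pre hρ]
    exact weightedCost_nonneg n hd pre ρ
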